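/- Let n = 2m, let F : F_{2^n} → F_{2^n} satisfy F(x^2) = F(x)^2 for all x and #S_F = 2^m, and assume ℓ(n) > m. Set T = #{u ∈ F_{2^m}^* : W_{F_u}(0) ≠ 0}, where F_{2^m} is the subfield of F_{2^n} with 2^m elements. If T ≠ 0, then the nonlinearity of F satisfies 𝒩_F ≤ 2^{n−1} − (1/2)·√( (2^{3m}/T) · (2^{3m}/#Im(F) − 2^{m+1} + 1) ). -/

import Mathlib

open Finset

/-- The Walsh transform `W_{F_a}(ω) = Σ_v (−1)^{Tr(a·F(v)) + Tr(ω·v)}`. -/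
noncomputable def walsh {K : Type*} [Field K] [Fintype K] [Algebra (ZMod 2) K]
    (F : K → K) (a ω : K) : ℤ :=
  ∑ v : K, if Algebra.trace (ZMod 2) K (a * F v) + Algebra.trace (ZMod 2) K (ω * v) = 0
    then 1 else -1

/-- The component `F_a` is bent: all Walsh values are `±2^m`. -/
def IsBent {K : Type*} [Field K] [Fintype K] [Algebra (ZMod 2) K]
    (m : ℕ) (F : K → K) (a : K) : Prop :=
  ∀ ω : K, walsh F a ω = 2 ^ m ∨ walsh F a ω = -(2 ^ m)

/-- The `F₂`-span of the Frobenius orbit `{γ, γ², γ⁴, …}` of `γ`. -/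
def frobSpan (K : Type*) [Field K] [Algebra (ZMod 2) K] (γ : K) : Submodule (ZMod 2) K :=
  Submodule.span (ZMod 2) (Set.range fun i : ℕ => γ ^ (2 ^ i))

/-- The nonlinearity `𝒩_F = 2^{n−1} − (1/2)·max{|W_{F_a}(ω)| : a ≠ 0, ω}`. -/
noncomputable def nonlinearity {K : Type*} [Field K] [Fintype K] [Algebra (ZMod 2) K]
    (n : ℕ) (F : K → K) : ℝ :=
  2 ^ (n - 1) - (1 / 2) *
    (⨆ a : {a : K // a ≠ 0}, ⨆ ω : K, (|walsh F (a : K) ω| : ℝ))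

section WalshBent

open Polynomial

variable {K : Type*} [Field K] [Fintype K] [Algebra (ZMod 2) K]

theorem zmod_two_eq_zero_or_one : ∀ r : ZMod 2, r = 0 ∨ r = 1 := by decide

/-- The canonical additive character `x ↦ (-1)^{Tr x}` with integer values. -/
noncomputable def traceChar (K : Type*) [Field K] [Algebra (ZMod 2) K] : AddChar K ℤ where
  toFun x := if Algebra.trace (ZMod 2) K x = 0 then 1 else -1
  map_zero_eq_one' := by simp
  map_add_eq_mul' x y := by
    rw [map_add]
    generalize Algebra.trace (ZMod 2) K x = s
    generalize Algebra.trace (ZMod 2) K y = t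
    revert s t
    decide

theorem traceChar_apply {K : Type*} [Field K] [Algebra (ZMod 2) K] (x : K) :
    traceChar K x = if Algebra.trace (ZMod 2) K x = 0 then 1 else -1 := rfl

theorem traceChar_isPrimitive : (traceChar K).IsPrimitive := by
  apply AddChar.IsPrimitive.of_ne_one
  obtain ⟨x, hx⟩ := Algebra.trace_surjective (ZMod 2) K 1
  refine AddChar.ne_one_iff.2 ⟨x, ?_⟩
  rw [traceChar_apply, hx]
  decide

theorem walsh_eq_sum_traceChar (F : K → K) (a ω : K) :
    walsh F a ω = ∑ v, traceChar K (a * F v + ω * v) := by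
  simp only [walsh, traceChar_apply, map_add]

theorem walsh_zero_right (F : K → K) (a : K) :
    walsh F a 0 = ∑ v, traceChar K (a * F v) := by
  simp [walsh_eq_sum_traceChar]

theorem walsh_zero_zero (F : K → K) : walsh F 0 0 = Fintype.card K := by
  simp [walsh_zero_right]

theorem trace_sq (x : K) :
    Algebra.trace (ZMod 2) K (x ^ 2) = Algebra.trace (ZMod 2) K x := by
  have h := Algebra.trace_eq_of_algEquiv (FiniteField.frobeniusAlgEquivOfAlgebraic (ZMod 2) K) x
  simpa using h

theorem walsh_sq {F : K → K} (hcomm : ∀ x, F (x ^ 2) = F x ^ 2) (a ω : K) :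
    walsh F (a ^ 2) (ω ^ 2) = walsh F a ω := by
  have : CharP K 2 := charP_of_injective_algebraMap' (ZMod 2) 2
  unfold walsh
  refine (Fintype.sum_equiv (frobeniusEquiv K 2).toEquiv _ _ fun v => ?_).symm
  simp [frobenius_def, hcomm, ← mul_pow, trace_sq]

theorem not_isBent_sq {m : ℕ} {F : K → K} (hcomm : ∀ x, F (x ^ 2) = F x ^ 2) {a : K}
    (ha : ¬ IsBent m F a) : ¬ IsBent m F (a ^ 2) := fun h =>
  ha fun ω => walsh_sq hcomm a ω ▸ h (ω ^ 2)

theorem not_isBent_zero {m : ℕ} (hm : 0 < m) (hcard : Fintype.card K = 2 ^ (2 * m))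
    (F : K → K) : ¬ IsBent m F 0 := by
  intro h
  have h0 := h 0
  rw [walsh_zero_zero, hcard] at h0
  have h1 : (2 : ℤ) ^ m < 2 ^ (2 * m) := pow_lt_pow_right₀ (by norm_num) (by omega)
  have h2 : (0 : ℤ) < 2 ^ m := by positivity
  push_cast at h0
  omega

theorem card_dvd_sum_walsh (F : K → K) (U : Submodule (ZMod 2) K) [Fintype U] :
    (Fintype.card U : ℤ) ∣ ∑ a : U, walsh F a 0 := by
  classical
  simp only [walsh_zero_right]
  rw [sum_comm]
  refine dvd_sum fun v _ => ?_
  let ψ : AddChar U ℤ :=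
    ((traceChar K).mulShift (F v)).compAddMonoidHom U.subtype.toAddMonoidHom
  have h : ∑ a : U, traceChar K (a * F v) = ∑ a : U, ψ a := by
    refine sum_congr rfl fun a _ => ?_
    simp [ψ, AddChar.mulShift_apply, mul_comm]
  rw [h, AddChar.sum_eq_ite]
  split_ifs <;> simp

/-- Nyberg's bound: a space of bent components has dimension at most `m`. -/
theorem card_le_of_forall_isBent {m : ℕ} (hm : 0 < m) (hcard : Fintype.card K = 2 ^ (2 * m))
    (F : K → K) (U : Submodule (ZMod 2) K) (hU : ∀ a ∈ U, a ≠ 0 → IsBent m F a) :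
    Nat.card U ≤ 2 ^ m := by
  classical
  have : Fintype U := Fintype.ofFinite _
  rw [Nat.card_eq_fintype_card]
  have hd := card_dvd_sum_walsh F U
  have hc : Fintype.card U = 2 ^ Module.finrank (ZMod 2) U := by
    simpa using Module.card_eq_pow_finrank (K := ZMod 2) (V := U)
  by_contra! hlt
  rw [hc] at hlt hd
  have hk : m < Module.finrank (ZMod 2) U := (Nat.pow_lt_pow_iff_right (by norm_num)).1 hlt
  have hd' : (2 : ℤ) ^ (m + 1) ∣ ∑ a : U, walsh F a 0 := by
    refine dvd_trans ?_ hd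
    push_cast
    exact pow_dvd_pow _ hk
  have hmod : ∀ a : U, (2 : ℤ) ^ (m + 1) ∣ walsh F a 0 - if a = 0 then 0 else 2 ^ m := by
    intro a
    split_ifs with ha
    · subst ha
      rw [ZeroMemClass.coe_zero, walsh_zero_zero, hcard, sub_zero]
      push_cast
      exact pow_dvd_pow _ (by omega)
    · rcases hU a a.2 (by simpa using ha) 0 with h | h <;> rw [h]
      · simp
      · exact ⟨-1, by ring⟩
  have hsum : (2 : ℤ) ^ (m + 1) ∣ ∑ a : U, if a = 0 then 0 else (2 : ℤ) ^ m := by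
    have := dvd_sub hd' (dvd_sum fun a (_ : a ∈ univ) => hmod a)
    rwa [sum_sub_distrib, sub_sub_cancel] at this
  have hval : (∑ a : U, if a = 0 then 0 else (2 : ℤ) ^ m)
      = 2 ^ Module.finrank (ZMod 2) U * 2 ^ m - 2 ^ m := by
    have : ∀ a : U, (if a = 0 then 0 else (2 : ℤ) ^ m) = 2 ^ m - if a = 0 then 2 ^ m else 0 := by
      intro a; split_ifs <;> simp
    simp only [this, sum_sub_distrib, sum_const, card_univ, hc]
    simp
  rw [hval] at hsum
  have h1 : (2 : ℤ) ^ (m + 1) ∣ 2 ^ Module.finrank (ZMod 2) U * 2 ^ m :=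
    (pow_dvd_pow _ hk).mul_right _
  have h2 : (2 : ℤ) ^ (m + 1) ∣ 2 ^ m := by
    have := dvd_sub h1 hsum
    rwa [sub_sub_cancel] at this
  have h3 := Int.le_of_dvd (by positivity) h2
  have h4 : (0 : ℤ) < 2 ^ m := by positivity
  rw [pow_succ] at h3
  omega

/-- If the number of non-bent components is `2 ^ m`, they are closed under addition. -/
theorem not_isBent_add {m : ℕ} (hm : 0 < m) (hcard : Fintype.card K = 2 ^ (2 * m))
    {F : K → K} (hSF : Set.ncard {a : K | ¬ IsBent m F a} = 2 ^ m) {a b : K}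
    (ha : ¬ IsBent m F a) (hb : ¬ IsBent m F b) : ¬ IsBent m F (a + b) := by
  classical
  have : CharP K 2 := charP_of_injective_algebraMap' (ZMod 2) 2
  intro hc
  have h0 : ¬ IsBent m F 0 := not_isBent_zero hm hcard F
  let P : Submodule (ZMod 2) K → Prop := fun U => a + b ∈ U ∧ ∀ x ∈ U, x ≠ 0 → IsBent m F x
  have hP : P (Submodule.span (ZMod 2) {a + b}) := by
    refine ⟨Submodule.mem_span_singleton_self _, fun x hx hx0 => ?_⟩
    obtain ⟨r, rfl⟩ := Submodule.mem_span_singleton.1 hx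
    rcases zmod_two_eq_zero_or_one r with rfl | rfl
    · simp at hx0
    · simpa using hc
  obtain ⟨U, hU⟩ := (Set.toFinite {U | P U}).exists_maximal ⟨_, hP⟩
  have hUc := card_le_of_forall_isBent hm hcard F U hU.1.2
  let f : {a : K | ¬ IsBent m F a} → K ⧸ U := fun x => U.mkQ x
  have hsurj : Function.Surjective f := by
    intro q
    obtain ⟨v, rfl⟩ := U.mkQ_surjective q
    by_cases hv : v ∈ U
    · exact ⟨⟨0, h0⟩, by simpa [f] using ((Submodule.Quotient.mk_eq_zero U).2 hv).symm⟩
    have hnP : ¬ P (U ⊔ Submodule.span (ZMod 2) {v}) := fun h =>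
      hv (hU.2 h le_sup_left (Submodule.mem_sup_right (Submodule.mem_span_singleton_self v)))
    have : ∃ x ∈ U ⊔ Submodule.span (ZMod 2) {v}, x ≠ 0 ∧ ¬ IsBent m F x := by
      by_contra! hcon
      exact hnP ⟨Submodule.mem_sup_left hU.1.1, hcon⟩
    obtain ⟨x, hx, hx0, hxb⟩ := this
    obtain ⟨u, hu, w, hw, rfl⟩ := Submodule.mem_sup.1 hx
    obtain ⟨r, rfl⟩ := Submodule.mem_span_singleton.1 hw
    rcases zmod_two_eq_zero_or_one r with rfl | rfl
    · simp only [zero_smul, add_zero] at hx0 hxb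
      exact absurd (hU.1.2 u hu hx0) hxb
    · refine ⟨⟨_, hxb⟩, ?_⟩
      simpa [f] using hu
  have hcardle : Nat.card {a : K | ¬ IsBent m F a} ≤ Nat.card (K ⧸ U) := by
    have h1 := U.card_eq_card_quotient_mul_card
    rw [Nat.card_eq_fintype_card, hcard] at h1
    rw [Nat.card_coe_set_eq, hSF]
    have h2 : 2 ^ m * 2 ^ m ≤ Nat.card (K ⧸ U) * 2 ^ m := by
      rw [← pow_add, ← two_mul, h1, mul_comm]
      gcongr
    exact Nat.le_of_mul_le_mul_right h2 (by positivity)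
  have hinj : Function.Injective f :=
    ((Nat.bijective_iff_surjective_and_card f).2
      ⟨hsurj, le_antisymm hcardle (Nat.card_le_card_of_surjective f hsurj)⟩).1
  have hab : f ⟨a, ha⟩ = f ⟨b, hb⟩ := by
    simp only [f, Submodule.mkQ_apply]
    rw [Submodule.Quotient.eq, CharTwo.sub_eq_add]
    exact hU.1.1
  have : a = b := by simpa using hinj hab
  rw [this, CharTwo.add_self_eq_zero] at hc
  exact h0 hc

/-- In a Frobenius-stable subspace, some element satisfies `x ^ 2 ^ d = x` only for those `d`
for which the whole subspace does. -/
theorem exists_mem_forall_pow_eq_imp (S : Submodule (ZMod 2) K) (hS : ∀ x ∈ S, x ^ 2 ∈ S) :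
    ∃ γ ∈ S, ∀ d : ℕ, γ ^ 2 ^ d = γ → ∀ x ∈ S, x ^ 2 ^ d = x := by
  let φ : K →ₗ[ZMod 2] K := (FiniteField.frobeniusAlgHom (ZMod 2) K).toLinearMap
  have hφ : ∀ x, φ x = x ^ 2 := fun x => by simp [φ]
  let ψ : S →ₗ[ZMod 2] S := φ.restrict fun x hx => by rw [hφ]; exact hS x hx
  have hψ : ∀ (d : ℕ) (x : S), (((ψ ^ d) x : S) : K) = x ^ 2 ^ d := by
    intro d
    induction d with
    | zero => simp
    | succ d ih =>
      intro x
      have h : ((ψ x : S) : K) = x ^ 2 := hφ x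
      rw [pow_succ, Module.End.mul_apply, ih, h, ← pow_mul, ← pow_succ']
  obtain ⟨g, hg⟩ := Module.exists_ker_toSpanSingleton_eq_annihilator (ZMod 2)[X] (Module.AEval' ψ)
  obtain ⟨γ, rfl⟩ := (Module.AEval'.of ψ).surjective g
  have key : ∀ (d : ℕ) (x : S), ((X : (ZMod 2)[X]) ^ d - 1) • Module.AEval'.of ψ x = 0 ↔
      (x : K) ^ 2 ^ d = x := by
    intro d x
    rw [← Module.AEval.of_aeval_smul, LinearEquiv.map_eq_zero_iff, map_sub, map_pow, aeval_X,
      map_one, sub_smul, one_smul, sub_eq_zero, Subtype.ext_iff, ← hψ]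
    rfl
  refine ⟨γ, γ.2, fun d hd x hx => ?_⟩
  have hmem : ((X : (ZMod 2)[X]) ^ d - 1) ∈ Module.annihilator (ZMod 2)[X] (Module.AEval' ψ) := by
    rw [← hg, LinearMap.mem_ker, LinearMap.toSpanSingleton_apply]
    exact (key d γ).2 hd
  exact (key d ⟨x, hx⟩).1 (Module.mem_annihilator.1 hmem _)

/-- A Frobenius-stable subspace of dimension `m` containing no field generator is the subfield
with `2 ^ m` elements. -/
theorem pow_eq_self_of_mem {m : ℕ} (hm : 0 < m) (hcard : Fintype.card K = 2 ^ (2 * m))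
    (S : Submodule (ZMod 2) K) (hS : ∀ x ∈ S, x ^ 2 ∈ S) (hSc : Nat.card S = 2 ^ m)
    (hgen : ∀ γ ∈ S, Subfield.closure {γ} ≠ ⊤) {x : K} (hx : x ∈ S) : x ^ 2 ^ m = x := by
  classical
  obtain ⟨γ, hγ, hd⟩ := exists_mem_forall_pow_eq_imp S hS
  set L := Subfield.closure {γ}
  have hγL : γ ∈ L := Subfield.subset_closure rfl
  have : Fintype L := Fintype.ofFinite _
  have hKL : Fintype.card K = Fintype.card L ^ Module.finrank L K := Module.card_eq_pow_finrank
  have hr0 : 0 < Module.finrank L K := Module.finrank_pos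
  obtain ⟨d, -, hLd⟩ := (Nat.dvd_prime_pow Nat.prime_two).1
    (show Fintype.card L ∣ 2 ^ (2 * m) by
      rw [← hcard, hKL]; exact dvd_pow_self _ hr0.ne')
  have hdr : 2 * m = d * Module.finrank L K := by
    rw [hcard, hLd, ← pow_mul] at hKL
    exact Nat.pow_right_injective le_rfl hKL
  have hr1 : Module.finrank L K ≠ 1 := by
    intro h1
    refine hgen γ hγ (SetLike.coe_injective ?_)
    apply Set.eq_of_subset_of_ncard_le (Set.subset_univ _)
    rw [h1, pow_one] at hKL
    rw [Set.ncard_univ, Nat.card_eq_fintype_card, hKL, ← Nat.card_coe_set_eq,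
      ← Nat.card_eq_fintype_card]
    rfl
  have hγd : γ ^ 2 ^ d = γ := by
    rw [← hLd]
    exact congrArg Subtype.val (FiniteField.pow_card (⟨γ, hγL⟩ : L))
  have hSd := hd d hγd
  have hd0 : d ≠ 0 := by rintro rfl; omega
  have hmd : m ≤ d := by
    have hne : (X ^ 2 ^ d - X : K[X]) ≠ 0 :=
      FiniteField.X_pow_card_pow_sub_X_ne_zero K hd0 (by norm_num)
    have hsub : (S : Set K) ⊆ ((X ^ 2 ^ d - X : K[X]).roots.toFinset : Set K) := by
      intro y hy
      simp [hne, hSd y hy]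
    have h1 := Set.ncard_le_ncard hsub (Set.toFinite _)
    rw [Set.ncard_coe_finset, ← Nat.card_coe_set_eq] at h1
    have h2 : (X ^ 2 ^ d - X : K[X]).roots.toFinset.card ≤ 2 ^ d :=
      (Multiset.toFinset_card_le _).trans ((card_roots' _).trans_eq
        (FiniteField.X_pow_card_pow_sub_X_natDegree_eq K hd0 (by norm_num)))
    have h3 : 2 ^ m ≤ 2 ^ d := by
      rw [← hSc]; exact h1.trans h2
    exact (Nat.pow_le_pow_iff_right (by norm_num)).1 h3
  have hdm : d = m := by
    have : 2 ≤ Module.finrank L K := by omega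
    nlinarith
  exact hdm ▸ hSd x hx

/-- Under the hypotheses on `F`, all non-bent components are indexed by the subfield with
`2 ^ m` elements. -/
theorem pow_eq_self_of_not_isBent {m : ℕ} (hm : 0 < m) (hcard : Fintype.card K = 2 ^ (2 * m))
    {F : K → K} (hcomm : ∀ x, F (x ^ 2) = F x ^ 2)
    (hSF : Set.ncard {a : K | ¬ IsBent m F a} = 2 ^ m)
    (hell : ∀ γ : K, Subfield.closure {γ} = ⊤ →
      m < Module.finrank (ZMod 2) (frobSpan K γ)) {u : K} (hu : ¬ IsBent m F u) :
    u ^ 2 ^ m = u := by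
  let S : Submodule (ZMod 2) K :=
    { carrier := {a | ¬ IsBent m F a}
      add_mem' := not_isBent_add hm hcard hSF
      zero_mem' := not_isBent_zero hm hcard F
      smul_mem' := fun r x hx => by
        rcases zmod_two_eq_zero_or_one r with rfl | rfl
        · simpa using not_isBent_zero hm hcard F
        · simpa using hx }
  have hS : ∀ x ∈ S, x ^ 2 ∈ S := fun x hx => not_isBent_sq hcomm hx
  have hSc : Nat.card S = 2 ^ m := hSF
  refine pow_eq_self_of_mem hm hcard S hS hSc (fun γ hγ htop => ?_) (show u ∈ S from hu)
  have hle : frobSpan K γ ≤ S := by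
    refine Submodule.span_le.2 ?_
    rintro _ ⟨i, rfl⟩
    induction i with
    | zero => simpa using hγ
    | succ i ih =>
      simp only [pow_succ 2 i, pow_mul γ]
      exact hS _ ih
  have h1 := Submodule.finrank_mono hle
  have h2 : Module.finrank (ZMod 2) S = m := by
    have h := Module.natCard_eq_pow_finrank (K := ZMod 2) (V := S)
    rw [hSc, Nat.card_zmod] at h
    exact (Nat.pow_right_injective le_rfl h).symm
  have h3 := hell γ htop
  omega

theorem sum_walsh_zero_sq (F : K → K) [DecidableEq K] :
    ∑ a, walsh F a 0 ^ 2 =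
      Fintype.card K * ∑ c ∈ univ.image F, (#{v | F v = c} : ℤ) ^ 2 := by
  have : CharP K 2 := charP_of_injective_algebraMap' (ZMod 2) 2
  have h1 : ∀ a, walsh F a 0 ^ 2 = ∑ v, ∑ w, traceChar K (a * (F v + F w)) := by
    intro a
    simp only [walsh_zero_right, sq, sum_mul_sum, mul_add, AddChar.map_add_eq_mul]
  have h2 : ∀ v, ∑ w, (if F v + F w = 0 then (Fintype.card K : ℤ) else 0)
      = Fintype.card K * #{w | F w = F v} := by
    intro v
    simp only [CharTwo.add_eq_zero, eq_comm (a := F v)]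
    rw [← sum_filter, sum_const, nsmul_eq_mul, mul_comm]
  have h3 : ∀ v, ∑ a, ∑ w, traceChar K (a * (F v + F w)) =
      Fintype.card K * #{w | F w = F v} := by
    intro v
    rw [sum_comm, ← h2 v]
    simp only [AddChar.sum_mulShift _ traceChar_isPrimitive, Nat.cast_ite, Nat.cast_zero]
  simp only [h1]
  rw [sum_comm]
  simp only [h3]
  rw [← mul_sum]
  congr 1
  rw [sum_comp (fun c => (#{w | F w = c} : ℤ)) F]
  simp [sq]

/-- The second moment of the Walsh values at `0` is bounded below by the image size. -/
theorem card_pow_three_le_ncard_range_mul_sum (F : K → K) :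
    (Fintype.card K : ℤ) ^ 3 ≤ (Set.range F).ncard * ∑ a, walsh F a 0 ^ 2 := by
  classical
  have himg : (Set.range F).ncard = #(univ.image F) := by
    rw [← Set.ncard_coe_finset]; simp
  have hcs := sq_sum_le_card_mul_sum_sq (s := univ.image F) (f := fun c => (#{v | F v = c} : ℤ))
  have htot : ∑ c ∈ univ.image F, (#{v | F v = c} : ℤ) = Fintype.card K := by
    exact_mod_cast (card_eq_sum_card_image F univ).symm
  rw [htot] at hcs
  rw [sum_walsh_zero_sq, himg]
  calc (Fintype.card K : ℤ) ^ 3 = Fintype.card K * (Fintype.card K : ℤ) ^ 2 := by ring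
    _ ≤ _ := mul_le_mul_of_nonneg_left hcs (by positivity)
    _ = _ := by ring

theorem abs_walsh_le_iSup (F : K → K) {a : K} (ha : a ≠ 0) (ω : K) :
    |(walsh F a ω : ℝ)| ≤ ⨆ a : {a : K // a ≠ 0}, ⨆ ω : K, (|walsh F (a : K) ω| : ℝ) :=
  (le_ciSup (f := fun ω => |(walsh F a ω : ℝ)|) (Set.finite_range _).bddAbove ω).trans
    (le_ciSup (f := fun a : {a : K // a ≠ 0} => ⨆ ω : K, |(walsh F (a : K) ω : ℝ)|)
      (Set.finite_range _).bddAbove ⟨a, ha⟩)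

/-- Upper bound for the second moment, splitting the components into the trivial one, the bent
ones and the remaining ones, which are supported on a set of size `T`. -/
theorem sum_walsh_zero_sq_le {m : ℕ} (hcard : Fintype.card K = 2 ^ (2 * m))
    {F : K → K} (hSF : Set.ncard {a : K | ¬ IsBent m F a} = 2 ^ m)
    (hsub : ∀ u, ¬ IsBent m F u → u ^ 2 ^ m = u) {M : ℝ}
    (hM : ∀ a ≠ 0, |(walsh F a 0 : ℝ)| ≤ M) :
    ∑ a, (walsh F a 0 : ℝ) ^ 2 ≤ 2 ^ (4 * m) + (2 ^ (2 * m) - 2 ^ m) * 2 ^ (2 * m) +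
      (Set.ncard {u : K | u ≠ 0 ∧ u ^ (2 ^ m) = u ∧ walsh F u 0 ≠ 0} : ℝ) * M ^ 2 := by
  classical
  have hnb : #{a | ¬ IsBent m F a} = 2 ^ m := by
    rw [← hSF, ← Set.ncard_coe_finset]; simp
  have hb : (#{a | IsBent m F a} : ℝ) = 2 ^ (2 * m) - 2 ^ m := by
    have h := card_filter_add_card_filter_not (s := (univ : Finset K)) (fun a => IsBent m F a)
    rw [hnb, card_univ, hcard] at h
    rw [eq_sub_iff_add_eq]
    exact_mod_cast h
  have hTc : Set.ncard {u : K | u ≠ 0 ∧ u ^ (2 ^ m) = u ∧ walsh F u 0 ≠ 0} =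
      #{u : K | u ≠ 0 ∧ u ^ (2 ^ m) = u ∧ walsh F u 0 ≠ 0} := by
    rw [← Set.ncard_coe_finset]; simp
  have hpt : ∀ a, (walsh F a 0 : ℝ) ^ 2 ≤ (if a = 0 then (2 : ℝ) ^ (4 * m) else 0) +
      (if IsBent m F a then (2 : ℝ) ^ (2 * m) else 0) +
      (if a ≠ 0 ∧ a ^ (2 ^ m) = a ∧ walsh F a 0 ≠ 0 then M ^ 2 else 0) := by
    intro a
    have hpos : (0 : ℝ) ≤
        (if a ≠ 0 ∧ a ^ (2 ^ m) = a ∧ walsh F a 0 ≠ 0 then M ^ 2 else 0) := by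
      split_ifs <;> positivity
    have hpos' : (0 : ℝ) ≤ if a = 0 then (2 : ℝ) ^ (4 * m) else 0 := by
      split_ifs <;> positivity
    by_cases hbent : IsBent m F a
    · have : (walsh F a 0 : ℝ) ^ 2 = 2 ^ (2 * m) := by
        rcases hbent 0 with h | h <;> rw [h] <;> push_cast <;> ring
      rw [if_pos hbent, this]
      linarith
    · rw [if_neg hbent]
      by_cases ha : a = 0
      · subst ha
        rw [walsh_zero_zero, hcard]
        simp [← pow_mul]
        ring_nf
        rfl
      · by_cases hw : walsh F a 0 = 0
        · rw [hw]
          simp [ha]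
        · rw [if_neg ha, if_pos ⟨ha, hsub a hbent, hw⟩, ← sq_abs]
          simpa using pow_le_pow_left₀ (abs_nonneg _) (hM a ha) 2
  refine (sum_le_sum fun a _ => hpt a).trans_eq ?_
  rw [sum_add_distrib, sum_add_distrib, ← sum_filter, ← sum_filter, ← sum_filter, sum_const,
    sum_const, sum_const, nsmul_eq_mul, nsmul_eq_mul, nsmul_eq_mul, hb, hTc,
    filter_eq' univ (0 : K)]
  simp

end WalshBent

/-- Let `n = 2m`, `F : F_{2^n} → F_{2^n}` commute with the Frobenius, `#S_F = 2^m`,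
`ℓ(n) > m`.  Set `T = #{u ∈ F_{2^m}^* : W_{F_u}(0) ≠ 0}` (where `F_{2^m}` is the set of
solutions of `x^{2^m} = x`).  If `T ≠ 0`, then
`𝒩_F ≤ 2^{n−1} − (1/2)·√((2^{3m}/T)·(2^{3m}/#Im(F) − 2^{m+1} + 1))`. -/
theorem stmt17 (m n : ℕ) (hm : 0 < m) (hn : n = 2 * m)
    (K : Type*) [Field K] [Fintype K] [Algebra (ZMod 2) K]
    (hcard : Fintype.card K = 2 ^ n)
    (F : K → K) (hcomm : ∀ x, F (x ^ 2) = (F x) ^ 2)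
    (hSF : Set.ncard {a : K | ¬ IsBent m F a} = 2 ^ m)
    (hell : ∀ γ : K, Subfield.closure {γ} = ⊤ →
      m < Module.finrank (ZMod 2) (frobSpan K γ))
    (T : ℕ)
    (hT : T = Set.ncard {u : K | u ≠ 0 ∧ u ^ (2 ^ m) = u ∧ walsh F u 0 ≠ 0})
    (hT0 : T ≠ 0) :
    nonlinearity n F ≤ 2 ^ (n - 1) - (1 / 2) *
      Real.sqrt (((2 : ℝ) ^ (3 * m) / T) *
        ((2 : ℝ) ^ (3 * m) / (Set.ncard (Set.range F) : ℝ) - 2 ^ (m + 1) + 1)) := by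
  subst hn
  have hsub : ∀ u, ¬ IsBent m F u → u ^ 2 ^ m = u := fun u =>
    pow_eq_self_of_not_isBent hm hcard hcomm hSF hell
  unfold nonlinearity
  set M := ⨆ a : {a : K // a ≠ 0}, ⨆ ω : K, (|walsh F (a : K) ω| : ℝ)
  have hMw : ∀ a ≠ 0, |(walsh F a 0 : ℝ)| ≤ M := fun a ha => abs_walsh_le_iSup F ha 0
  have hupper := sum_walsh_zero_sq_le hcard hSF hsub hMw
  rw [← hT] at hupper
  have hlower : ((2 : ℝ) ^ (2 * m)) ^ 3 ≤
      (Set.range F).ncard * ∑ a, (walsh F a 0 : ℝ) ^ 2 := by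
    have h := card_pow_three_le_ncard_range_mul_sum F
    rw [hcard] at h
    exact_mod_cast h
  have hI : (0 : ℝ) < (Set.range F).ncard := by
    exact_mod_cast (Set.ncard_pos (Set.toFinite _)).2 (Set.range_nonempty F)
  have hTpos : (0 : ℝ) < T := by exact_mod_cast Nat.pos_of_ne_zero hT0
  have hM0 : 0 ≤ M := (abs_nonneg _).trans (hMw 1 one_ne_zero)
  have hkey : (2 : ℝ) ^ (3 * m) / T *
      ((2 : ℝ) ^ (3 * m) / (Set.range F).ncard - 2 ^ (m + 1) + 1) ≤ M ^ 2 := by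
    rw [div_mul_eq_mul_div, div_le_iff₀ hTpos]
    have h1 : ((2 : ℝ) ^ (2 * m)) ^ 3 / (Set.range F).ncard ≤
        ∑ a, (walsh F a 0 : ℝ) ^ 2 := by
      rw [div_le_iff₀' hI]
      exact hlower
    have h2 := h1.trans hupper
    have h3 : (2 : ℝ) ^ (3 * m) *
        ((2 : ℝ) ^ (3 * m) / (Set.range F).ncard - 2 ^ (m + 1) + 1) =
        ((2 : ℝ) ^ (2 * m)) ^ 3 / (Set.range F).ncard -
          (2 ^ (4 * m) + (2 ^ (2 * m) - 2 ^ m) * 2 ^ (2 * m)) := by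
      simp only [mul_comm _ m, pow_mul, pow_succ]
      ring
    rw [h3]
    linarith
  have := Real.sqrt_le_iff.2 ⟨hM0, hkey⟩
  linarith
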